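/- Let k and p be integers with k ≤ p. Then ν_{k,p}(N_u) ≥ c_k for every u ∈ 𝒫 with ‖dom(u)‖ ≤ 1; in particular, ν_{k,p}(T) ≥ c_k ≥ 8. -/

import Mathlib

open Ordinal Filter
open scoped ENNReal
/-- `A ≤ₛ B`: same cardinality and the increasing enumeration of `A` is pointwise `≤`
that of `B`. -/
def SpreadLE (A B : Finset ℕ) : Prop :=
  List.Forall₂ (· ≤ ·) (A.sort (· ≤ ·)) (B.sort (· ≤ ·))
open Classical in
/-- The finite initial segment `A ∩ [0,n)` of a set `A ⊆ ℕ`. -/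
noncomputable def initSeg (A : Set ℕ) (n : ℕ) : Finset ℕ :=
  (Finset.range n).filter (· ∈ A)

/-- An admissible norm on finite subsets of `ℕ`: vanishing on `∅`, equal to `1` on
singletons, monotone, subadditive, unbounded along every infinite set, and spreading. -/
structure IsAdmissibleNorm (nrm : Finset ℕ → ℕ) : Prop where
  empty : nrm ∅ = 0
  singleton : ∀ n : ℕ, nrm {n} = 1
  mono : ∀ A B : Finset ℕ, A ⊆ B → nrm A ≤ nrm B
  subadd : ∀ A B : Finset ℕ, nrm (A ∪ B) ≤ nrm A + nrm B
  unbounded : ∀ A : Set ℕ, A.Infinite →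
    Filter.Tendsto (fun n => nrm (initSeg A n)) Filter.atTop Filter.atTop
  spreading : ∀ A B : Finset ℕ, SpreadLE A B → nrm A ≤ nrm B
/-- The space `T = ∏ₙ 2ⁿ`. -/
abbrev TT : Type := (n : ℕ) → Fin (2 ^ n)

/-- The atom of rank `m` (basic cylinder) determined by the first `m` coordinates of `x`;
the atoms of `ℬ_m` are exactly the sets `cylSet m x`. -/
def cylSet (m : ℕ) (x : TT) : Set TT := {y | ∀ i < m, y i = x i}

/-- Membership in `ℬ_n`: the set depends only on coordinates `< n`. -/
def memB (n : ℕ) (X : Set TT) : Prop :=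
  ∀ x y : TT, (∀ i < n, x i = y i) → (x ∈ X ↔ y ∈ X)

/-- `X` does not depend on coordinates `< m`. -/
def indepBelow (m : ℕ) (X : Set TT) : Prop :=
  ∀ x y : TT, (∀ i, m ≤ i → x i = y i) → (x ∈ X ↔ y ∈ X)

/-- The retraction `π_A : T → A` for the atom `A = cylSet m x`. -/
def piMap (m : ℕ) (x : TT) (z : TT) : TT := fun i => if i < m then x i else z i

/-- `[X]_n`: the smallest member of `ℬ_n` containing `X`. -/
def clsn (n : ℕ) (X : Set TT) : Set TT := {y | ∃ x ∈ X, ∀ i < n, y i = x i}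

/-- `int_n(X)`: the largest member of `ℬ_n` contained in `X`. -/
def intn (n : ℕ) (X : Set TT) : Set TT := {y | cylSet n y ⊆ X}

/-- A submeasure on the algebra `ℬ` of clopen subsets of `T`. -/
structure IsSubmeasureOn (ν : Set TT → ℝ≥0∞) : Prop where
  empty : ν ∅ = 0
  mono : ∀ X Y : Set TT, IsClopen X → IsClopen Y → X ⊆ Y → ν X ≤ ν Y
  subadd : ∀ X Y : Set TT, IsClopen X → IsClopen Y → ν (X ∪ Y) ≤ ν X + ν Y

/-- The outer submeasure `φ_𝓔` associated to a class `𝓔` of marked weighted sets: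
the infimum of total weights of finite subfamilies covering `X` (and `+∞` if there is
no such cover). -/
noncomputable def phiE (E : Set (Set TT × Finset ℕ × ℝ≥0∞)) (X : Set TT) : ℝ≥0∞ :=
  ⨅ (F : Finset (Set TT × Finset ℕ × ℝ≥0∞)) (_ : ↑F ⊆ E) (_ : X ⊆ ⋃ c ∈ F, c.1),
    ∑ c ∈ F, c.2.2

/-- `X` is `(m,n,φ)`-thin. -/
def IsThin (φ : Set TT → ℝ≥0∞) (m n : ℕ) (X : Set TT) : Prop :=
  ∀ x : TT, ∃ H : Set TT, memB n H ∧ H ⊆ cylSet m x \ X ∧ 1 < φ (piMap m x ⁻¹' H)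

/-- `X` is `(I,φ)`-thin. -/
def IsThinOn (φ : Set TT → ℝ≥0∞) (I : Finset ℕ) (X : Set TT) : Prop :=
  ∀ m ∈ I, ∀ n ∈ I, m < n → IsThin φ m n X

/-- `a_k = 1/(k+5)³`. -/
noncomputable def aK (k : ℕ) : ℝ := 1 / ((k : ℝ) + 5) ^ 3

/-- `M_k = 2^{2k+12} · 2^{(k+4)(k+5)³}`. -/
def MK (k : ℕ) : ℕ := 2 ^ (2 * k + 12) * 2 ^ ((k + 4) * (k + 5) ^ 3)

/-- The weight bound `2^{-k} (M_k / ‖I‖)^{a_k}`. -/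
noncomputable def weightBound (nrm : Finset ℕ → ℕ) (k : ℕ) (I : Finset ℕ) : ℝ≥0∞ :=
  (2 : ℝ≥0∞) ^ (-(k : ℝ)) * ((MK k : ℝ≥0∞) / (nrm I : ℝ≥0∞)) ^ aK k

/-- The class `E_{k,p}` built from the submeasure `φ = ν_{k+1,p}`. -/
noncomputable def EEcl (nrm : Finset ℕ → ℕ) (φ : Set TT → ℝ≥0∞) (k : ℕ) :
    Set (Set TT × Finset ℕ × ℝ≥0∞) :=
  {c | IsClopen c.1 ∧ nrm c.2.1 ≤ MK k ∧ weightBound nrm k c.2.1 ≤ c.2.2 ∧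
       IsThinOn φ c.2.1 c.1}

/-- `Cstage nrm p j = C_{p-j, p}`, defined by downward recursion on `k = p - j`. -/
noncomputable def Cstage (nrm : Finset ℕ → ℕ) (p : ℕ) : ℕ → Set (Set TT × Finset ℕ × ℝ≥0∞)
  | 0 => ∅
  | j + 1 => Cstage nrm p j ∪ EEcl nrm (phiE (Cstage nrm p j)) (p - (j + 1))

/-- The family `C_{k,p}`. -/
noncomputable def Ckp (nrm : Finset ℕ → ℕ) (k p : ℕ) : Set (Set TT × Finset ℕ × ℝ≥0∞) :=
  Cstage nrm p (p - k)

/-- The submeasure `ν_{k,p} = φ_{C_{k,p}}`. -/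
noncomputable def nuKP (nrm : Finset ℕ → ℕ) (k p : ℕ) : Set TT → ℝ≥0∞ :=
  phiE (Ckp nrm k p)

/-- The ultrafilter-limit submeasure `ν_k(E) = lim_{p→𝒰} ν_{k,p}(E)`. -/
noncomputable def nuK (nrm : Finset ℕ → ℕ) (U : Ultrafilter ℕ) (k : ℕ) (X : Set TT) : ℝ≥0∞ :=
  limUnder (U : Filter ℕ) fun p => nuKP nrm k p X
/-- `𝒫`: partial functions `u` with finite domain such that `u(k) < 2^k` on the domain
(normalized to be `0` off the domain). -/
structure PFn where
  dom : Finset ℕ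
  val : ℕ → ℕ
  lt : ∀ k ∈ dom, val k < 2 ^ k
  out : ∀ k ∉ dom, val k = 0
/-- The basic clopen set `N_u = {x ∈ T : u ⊆ x}`. -/
def Nset (u : PFn) : Set TT := {x | ∀ k ∈ u.dom, (x k : ℕ) = u.val k}

/-- The constants `c_0 = 8`, `c_{k+1} = 4^{a_k}·c_k`. -/
noncomputable def cK : ℕ → ℝ≥0∞
  | 0 => 8
  | k + 1 => (4 : ℝ≥0∞) ^ aK k * cK k


section aux

lemma aK_pos (k : ℕ) : 0 < aK k := by unfold aK; positivity

lemma aK_anti {k r : ℕ} (h : k ≤ r) : aK r ≤ aK k := by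
  unfold aK
  have : (k:ℝ) ≤ r := by exact_mod_cast h
  gcongr

lemma cK_ge (k : ℕ) : (8 : ℝ≥0∞) ≤ cK k := by
  induction k with
  | zero => simp [cK]
  | succ k ih =>
    rw [cK]
    calc (8:ℝ≥0∞) ≤ 1 * cK k := by simpa using ih
      _ ≤ _ := by
        gcongr
        exact ENNReal.one_le_rpow (by norm_num) (aK_pos k)

lemma cK_le_aux (k : ℕ) : cK k ≤ 8 * (2 : ℝ≥0∞) ^ (1 - 1 / ((k : ℝ) + 4)) := by
  induction k with
  | zero =>
    rw [cK]
    calc (8:ℝ≥0∞) = 8 * 1 := by simp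
      _ ≤ _ := by
        gcongr
        exact ENNReal.one_le_rpow (by norm_num) (by norm_num)
  | succ k ih =>
    rw [cK]
    have h4 : (4:ℝ≥0∞) ^ aK k = 2 ^ (2 * aK k) := by
      rw [ENNReal.rpow_mul]; congr 1
      norm_num [ENNReal.rpow_ofNat]
    rw [h4]
    calc (2:ℝ≥0∞) ^ (2 * aK k) * cK k ≤ 2 ^ (2 * aK k) * (8 * (2 : ℝ≥0∞) ^ (1 - 1 / ((k : ℝ) + 4))) := by gcongr
      _ = 8 * (2 ^ (2 * aK k) * (2 : ℝ≥0∞) ^ (1 - 1 / ((k : ℝ) + 4))) := by ring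
      _ = 8 * (2 ^ (2 * aK k + (1 - 1 / ((k : ℝ) + 4)))) := by
        rw [ENNReal.rpow_add _ _ (by norm_num) (by norm_num)]
      _ ≤ _ := by
        gcongr
        · norm_num
        unfold aK
        push_cast
        have hk : (0:ℝ) ≤ k := by positivity
        have h1 : 1 / ((k:ℝ)+4) - 1 / ((k:ℝ)+1+4) = 1 / (((k:ℝ)+4) * (k+5)) := by
          field_simp; ring
        have h2 : 2 * (1 / ((k:ℝ)+5)^3) ≤ 1 / (((k:ℝ)+4) * (k+5)) := by
          rw [mul_one_div, div_le_div_iff₀ (by positivity) (by positivity)]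
          nlinarith [mul_nonneg hk hk, mul_nonneg hk (mul_nonneg hk hk)]
        linarith

lemma cK_le (k : ℕ) : cK k ≤ 16 := by
  refine (cK_le_aux k).trans ?_
  calc 8 * (2 : ℝ≥0∞) ^ (1 - 1 / ((k : ℝ) + 4)) ≤ 8 * 2 ^ (1:ℝ) := by
        gcongr
        · norm_num
        · have : (0:ℝ) ≤ 1 / ((k : ℝ) + 4) := by positivity
          linarith
    _ = 16 := by norm_num

lemma wb_ge (nrm : Finset ℕ → ℕ) (k : ℕ) (I : Finset ℕ) (h : nrm I ≤ MK k) :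
    (2 : ℝ≥0∞) ^ (-(k : ℝ)) ≤ weightBound nrm k I := by
  unfold weightBound
  calc (2 : ℝ≥0∞) ^ (-(k : ℝ)) = (2 : ℝ≥0∞) ^ (-(k : ℝ)) * 1 := by simp
    _ ≤ _ := by
      gcongr
      refine ENNReal.one_le_rpow ?_ (aK_pos k)
      by_cases h0 : nrm I = 0
      · rw [h0, Nat.cast_zero, ENNReal.div_zero]
        · simp
        · simp [MK]
      · rw [ENNReal.le_div_iff_mul_le (Or.inl (by exact_mod_cast h0)) (Or.inl (by simp))]
        simpa using h

lemma wb_scale (nrm : Finset ℕ → ℕ) (k D : ℕ) (I J : Finset ℕ) (hD : D ≠ 0)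
    (h : nrm I ≤ D * nrm J) :
    weightBound nrm k J ≤ (D : ℝ≥0∞) ^ aK k * weightBound nrm k I := by
  unfold weightBound
  have hM : (MK k : ℝ≥0∞) / (nrm J) ≤ D * ((MK k : ℝ≥0∞) / nrm I) := by
    by_cases h0 : nrm I = 0
    · rw [h0, Nat.cast_zero, ENNReal.div_zero (by simp [MK]), ENNReal.mul_top (by exact_mod_cast hD)]
      exact le_top
    · have hJ : nrm J ≠ 0 := by
        rintro hJ; rw [hJ] at h; omega
      rw [ENNReal.div_le_iff (by exact_mod_cast hJ) (by simp)]
      calc (MK k : ℝ≥0∞) = (MK k / nrm I) * nrm I := by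
            rw [ENNReal.div_mul_cancel (by exact_mod_cast h0) (by simp)]
        _ ≤ (MK k / nrm I) * (D * nrm J) := by gcongr; exact_mod_cast h
        _ = _ := by ring
  calc (2 : ℝ≥0∞) ^ (-(k : ℝ)) * ((MK k : ℝ≥0∞) / (nrm J : ℝ≥0∞)) ^ aK k
      ≤ (2 : ℝ≥0∞) ^ (-(k : ℝ)) * (D * ((MK k : ℝ≥0∞) / nrm I)) ^ aK k := by
        gcongr; exact (aK_pos k).le
    _ = _ := by rw [ENNReal.mul_rpow_of_nonneg _ _ (aK_pos k).le]; ring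

lemma wb_large (nrm : Finset ℕ → ℕ) (k : ℕ) (I : Finset ℕ) (h : weightBound nrm k I < 16) :
    2 ^ (2 * k + 12) ≤ nrm I := by
  by_contra hlt
  push Not at hlt
  refine absurd h (not_lt.mpr ?_)
  unfold weightBound
  have h1 : ((2:ℝ≥0∞) ^ ((k + 4) * (k + 5) ^ 3)) ≤ (MK k : ℝ≥0∞) / nrm I := by
    refine ENNReal.le_div_iff_mul_le (Or.inr (by simp [MK])) (Or.inl (by simp)) |>.2 ?_
    unfold MK
    push_cast
    rw [mul_comm]
    gcongr
    exact_mod_cast hlt.le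
  have h2 : ((2:ℝ≥0∞) ^ ((k + 4) * (k + 5) ^ 3)) ^ aK k = 2 ^ (k + 4) := by
    rw [← ENNReal.rpow_natCast, ← ENNReal.rpow_mul, ← ENNReal.rpow_natCast]
    congr 1
    unfold aK; push_cast
    field_simp
  calc (16:ℝ≥0∞) = 2 ^ (-(k : ℝ)) * 2 ^ (k + 4) := by
        rw [pow_add, ← ENNReal.rpow_natCast 2 k, ← mul_assoc, ← ENNReal.rpow_add _ _ (by norm_num) (by norm_num)]
        norm_num
    _ ≤ _ := by
      rw [← h2]
      gcongr
      exact (aK_pos k).le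

lemma phiE_le_sum {ι : Type*} (E : Set (Set TT × Finset ℕ × ℝ≥0∞)) (X : Set TT)
    (S : Finset ι) (f : ι → Set TT × Finset ℕ × ℝ≥0∞) (hf : ∀ i ∈ S, f i ∈ E)
    (hX : X ⊆ ⋃ i ∈ S, (f i).1) : phiE E X ≤ ∑ i ∈ S, (f i).2.2 := by
  classical
  unfold phiE
  refine iInf_le_of_le (S.image f) ?_
  refine iInf_le_of_le ?_ (iInf_le_of_le ?_ ?_)
  · intro c hc
    simp only [Finset.coe_image, Set.mem_image] at hc
    obtain ⟨i, hi, rfl⟩ := hc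
    exact hf i hi
  · refine hX.trans ?_
    simp
  · exact Finset.sum_image_le_of_nonneg (by simp)

lemma clopen_of_memB {n : ℕ} {X : Set TT} (h : memB n X) : IsClopen X := by
  have : X = (fun (x : TT) (i : Fin n) => x i) ⁻¹' ((fun (x : TT) (i : Fin n) => x i) '' X) := by
    ext y
    constructor
    · intro hy; exact ⟨y, hy, rfl⟩
    · rintro ⟨x, hx, hxy⟩
      exact (h x y fun i hi => congrFun hxy ⟨i, hi⟩).1 hx
  rw [this]
  exact (isClopen_discrete _).preimage (by fun_prop)

lemma nrm_le_card {nrm : Finset ℕ → ℕ} (hn : IsAdmissibleNorm nrm) (A : Finset ℕ) :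
    nrm A ≤ A.card := by
  induction A using Finset.induction_on with
  | empty => simp [hn.empty]
  | insert a s ha ih =>
    rw [Finset.card_insert_of_notMem ha, Finset.insert_eq]
    have := hn.subadd {a} s
    rw [hn.singleton] at this
    omega

lemma nrm_biUnion {nrm : Finset ℕ → ℕ} (hn : IsAdmissibleNorm nrm) {τ : Type*} (S : Finset τ)
    (f : τ → Finset ℕ) : nrm (S.biUnion f) ≤ ∑ i ∈ S, nrm (f i) := by
  classical
  induction S using Finset.induction_on with
  | empty => simp [hn.empty]
  | insert a s ha ih =>
    rw [Finset.sum_insert ha, Finset.biUnion_insert]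
    have := hn.subadd (f a) (s.biUnion f)
    omega

lemma nrm_blocked {nrm : Finset ℕ → ℕ} (hn : IsAdmissibleNorm nrm) (D : Finset ℕ)
    (hD : nrm D ≤ 1) (A : Finset ℕ)
    (hA : ∀ m ∈ A, ∀ n ∈ A, m < n → ∃ d ∈ D, m ≤ d ∧ d < n) : nrm A ≤ 2 := by
  classical
  rcases A.eq_empty_or_nonempty with rfl | hne
  · simp [hn.empty]
  set M := A.max' hne with hM
  set A' := A.erase M with hA'
  have hAA : A = {M} ∪ A' := by
    rw [← Finset.insert_eq, hA', Finset.insert_erase (A.max'_mem hne)]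
  let f : ℕ → ℕ := fun x => sInf {d | d ∈ D ∧ x ≤ d}
  have hlt : ∀ x ∈ A', x < M := fun x hx =>
    lt_of_le_of_ne (A.le_max' x (Finset.mem_of_mem_erase hx)) (Finset.ne_of_mem_erase hx)
  have hf : ∀ x ∈ A', f x ∈ D ∧ x ≤ f x := by
    intro x hx
    obtain ⟨d, hd, h1, _⟩ := hA x (Finset.mem_of_mem_erase hx) M (A.max'_mem hne) (hlt x hx)
    exact Nat.sInf_mem (s := {d | d ∈ D ∧ x ≤ d}) ⟨d, hd, h1⟩
  have hmono : ∀ x ∈ A', ∀ y ∈ A', x < y → f x < f y := by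
    intro x hx y hy hxy
    obtain ⟨d, hd, h1, h2⟩ := hA x (Finset.mem_of_mem_erase hx) y (Finset.mem_of_mem_erase hy) hxy
    have : f x ≤ d := Nat.sInf_le (s := {d | d ∈ D ∧ x ≤ d}) ⟨hd, h1⟩
    exact lt_of_lt_of_le (this.trans_lt h2) (hf y hy).2
  have hs : SpreadLE A' (A'.image f) := by
    unfold SpreadLE
    have hp : ((A'.sort (· ≤ ·)).map f).Pairwise (· < ·) := by
      rw [List.pairwise_map]
      refine List.Pairwise.imp_of_mem ?_ (Finset.sortedLT_sort A').pairwise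
      intro a b ha hb hab
      exact hmono a (by simpa using ha) b (by simpa using hb) hab
    have he : (A'.image f).sort (· ≤ ·) = (A'.sort (· ≤ ·)).map f := by
      have : A'.image f = ((A'.sort (· ≤ ·)).map f).toFinset := by
        ext; simp
      rw [this, List.toFinset_sort]
      · exact hp.imp le_of_lt
      · exact hp.imp ne_of_lt
    rw [he, List.forall₂_map_right_iff, List.forall₂_same]
    intro x hx
    exact (hf x (by simpa using hx)).2
  have h1 := hn.spreading _ _ hs
  have h2 : nrm (A'.image f) ≤ nrm D := hn.mono _ _ (by
    intro d hd
    obtain ⟨x, hx, rfl⟩ := Finset.mem_image.1 hd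
    exact (hf x hx).1)
  have h3 := hn.subadd {M} A'
  rw [hn.singleton, ← hAA] at h3
  omega

lemma select {nrm : Finset ℕ → ℕ} (hn : IsAdmissibleNorm nrm) (D : Finset ℕ)
    (hD : nrm D ≤ 1) {τ : Type*} (I : τ → Finset ℕ) (N : ℕ) : ∀ (S : Finset τ), S.card = N →
    ∀ a : ℕ, (∀ t ∈ S, 3 * N ≤ nrm ((I t).filter (a ≤ ·))) →
    ∃ m n : τ → ℕ, (∀ t ∈ S, m t ∈ I t ∧ n t ∈ I t ∧ a ≤ m t ∧ m t < n t ∧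
      (∀ d ∈ D, ¬ (m t ≤ d ∧ d < n t))) ∧
      (∀ t ∈ S, ∀ t' ∈ S, t ≠ t' → n t ≤ m t' ∨ n t' ≤ m t) := by
  classical
  induction N with
  | zero =>
    intro S hS a _
    rw [Finset.card_eq_zero] at hS
    subst hS
    exact ⟨fun _ => 0, fun _ => 0, by simp, by simp⟩
  | succ N ih =>
    intro S hS a h
    let P : ℕ → Prop := fun n => ∃ t ∈ S, ∃ m ∈ I t, n ∈ I t ∧ a ≤ m ∧ m < n ∧
      ∀ d ∈ D, ¬ (m ≤ d ∧ d < n)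
    have hP : ∃ n, P n := by
      by_contra hcon
      push Not at hcon
      obtain ⟨t, ht⟩ : S.Nonempty := by rw [← Finset.card_pos]; omega
      have := nrm_blocked hn D hD ((I t).filter (a ≤ ·)) (by
        intro m hm n hn' hmn
        rw [Finset.mem_filter] at hm hn'
        by_contra hc
        push Not at hc
        exact hcon n ⟨t, ht, m, hm.1, hn'.1, hm.2, hmn, fun d hd hh => absurd (hc d hd hh.1) (by omega)⟩)
      have := h t ht
      omega
    set n0 := Nat.find hP with hn0
    obtain ⟨t0, ht0, m0, hm0, hn0I, ham, hmn, hav⟩ := Nat.find_spec hP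
    rw [← hn0] at hn0I hmn hav
    obtain ⟨m, n, h1, h2⟩ := ih (S.erase t0) (by rw [Finset.card_erase_of_mem ht0]; omega) n0 (by
      intro t ht
      have ht' := Finset.mem_of_mem_erase ht
      have hb := nrm_blocked hn D hD ((I t).filter (fun x => a ≤ x ∧ x < n0)) (by
        intro m hm n hn' hmn
        rw [Finset.mem_filter] at hm hn'
        by_contra hc
        push Not at hc
        exact Nat.find_min hP hn'.2.2 ⟨t, ht', m, hm.1, hn'.1, hm.2.1, hmn, fun d hd hh => absurd (hc d hd hh.1) (by omega)⟩)
      have hs : (I t).filter (a ≤ ·) ⊆ (I t).filter (fun x => a ≤ x ∧ x < n0) ∪ (I t).filter (n0 ≤ ·) := by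
        intro x hx
        simp only [Finset.mem_filter, Finset.mem_union] at hx ⊢
        rcases lt_or_ge x n0 with h | h
        · exact Or.inl ⟨hx.1, hx.2, h⟩
        · exact Or.inr ⟨hx.1, h⟩
      have := hn.mono _ _ hs
      have := hn.subadd ((I t).filter (fun x => a ≤ x ∧ x < n0)) ((I t).filter (n0 ≤ ·))
      have := h t ht'
      omega)
    refine ⟨Function.update m t0 m0, Function.update n t0 n0, ?_, ?_⟩
    · intro t ht
      by_cases htt : t = t0
      · subst htt
        simp only [Function.update_self]
        exact ⟨hm0, hn0I, ham, hmn, hav⟩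
      · simp only [Function.update_of_ne htt]
        obtain ⟨a1, a2, a3, a4, a5⟩ := h1 t (Finset.mem_erase.2 ⟨htt, ht⟩)
        exact ⟨a1, a2, by omega, a4, a5⟩
    · intro t ht t' ht' hne
      by_cases htt : t = t0
      · subst htt
        rw [Function.update_self, Function.update_of_ne hne.symm]
        exact Or.inl (h1 t' (Finset.mem_erase.2 ⟨hne.symm, ht'⟩)).2.2.1
      · by_cases htt' : t' = t0
        · subst htt'
          simp only [Function.update_self, Function.update_of_ne htt]
          exact Or.inr (h1 t (Finset.mem_erase.2 ⟨htt, ht⟩)).2.2.1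
        · rw [Function.update_of_ne htt, Function.update_of_ne htt', Function.update_of_ne htt, Function.update_of_ne htt']
          exact h2 t (Finset.mem_erase.2 ⟨htt, ht⟩) t' (Finset.mem_erase.2 ⟨htt', ht'⟩) hne

noncomputable def XiAux (S : (j : ℕ) → TT → TT → Fin (2 ^ j)) (z0 y : TT) : (j : ℕ) → Fin (2 ^ j)
  | j => S j y (fun i => if _h : i < j then XiAux S z0 y i else z0 i)
termination_by j => j

lemma XiAux_eq (S : (j : ℕ) → TT → TT → Fin (2 ^ j)) (z0 y : TT) (j : ℕ) :
    XiAux S z0 y j = S j y (piMap j (XiAux S z0 y) z0) := by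
  conv_lhs => rw [XiAux]
  congr 1

lemma thin_pull (φ : Set TT → ℝ≥0∞) (X : Set TT) (Xi : TT → TT)
    (hc : ∀ y y' : TT, ∀ j, (∀ i ≤ j, y i = y' i) → Xi y j = Xi y' j) (m m' n : ℕ)
    (hmm : m ≤ n) (hm'n : m' ≤ n) (hid : ∀ j, m ≤ j → j < m' → ∀ y, Xi y j = y j)
    (hX : IsThin φ m m' X) : IsThin φ m n (Xi ⁻¹' X) := by
  intro x
  obtain ⟨H, hB, hH, hφ⟩ := hX (Xi x)
  refine ⟨cylSet m x ∩ Xi ⁻¹' H, ?_, ?_, ?_⟩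
  · intro y y' hyy
    have h2 : Xi y ∈ H ↔ Xi y' ∈ H :=
      hB _ _ fun i hi => hc _ _ _ fun i' hi' => hyy _ (by omega)
    have h1 : y ∈ cylSet m x ↔ y' ∈ cylSet m x := by
      simp only [cylSet, Set.mem_ofPred_eq]
      refine forall₂_congr fun i hi => ?_
      rw [hyy i (by omega)]
    simp only [Set.mem_inter_iff, Set.mem_preimage, h1, h2]
  · rintro y ⟨h1, h2⟩
    exact ⟨h1, (hH h2).2⟩
  · have : piMap m x ⁻¹' (cylSet m x ∩ Xi ⁻¹' H) = piMap m (Xi x) ⁻¹' H := by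
      ext z
      simp only [Set.mem_preimage, Set.mem_inter_iff]
      have h1 : piMap m x z ∈ cylSet m x := by
        intro i hi; simp [piMap, hi]
      simp only [h1, true_and]
      refine hB _ _ fun i hi => ?_
      by_cases him : i < m
      · simp only [piMap, him, if_true]
        refine hc _ _ _ fun i' hi' => ?_
        rw [piMap, if_pos (by omega)]
      · rw [hid i (by omega) hi]
        simp [piMap, him]
    rw [this]; exact hφ

lemma thin_cls (φ : Set TT → ℝ≥0∞) (X : Set TT) (m n n' : ℕ) (h : n ≤ n')
    (hX : IsThin φ m n X) : IsThin φ m n (clsn n' X) := by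
  intro x
  obtain ⟨H, hB, hH, hφ⟩ := hX x
  refine ⟨H, hB, ?_, hφ⟩
  intro y hy
  refine ⟨(hH hy).1, ?_⟩
  rintro ⟨z, hz, hyz⟩
  exact (hH ((hB y z fun i hi => hyz i (by omega)).1 hy)).2 hz

lemma memB_clsn (n : ℕ) (X : Set TT) : memB n (clsn n X) := by
  intro x y hxy
  constructor
  · rintro ⟨z, hz, h⟩
    exact ⟨z, hz, fun i hi => (hxy i hi).symm.trans (h i hi)⟩
  · rintro ⟨z, hz, h⟩
    exact ⟨z, hz, fun i hi => (hxy i hi).trans (h i hi)⟩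

lemma continuous_caus (Xi : TT → TT)
    (hc : ∀ y y' : TT, ∀ j, (∀ i ≤ j, y i = y' i) → Xi y j = Xi y' j) : Continuous Xi := by
  refine continuous_pi fun j => ?_
  refine continuous_def.2 fun s _ => ?_
  refine (clopen_of_memB (n := j + 1) ?_).isOpen
  intro x y hxy
  simp only [Set.mem_preimage]
  rw [hc x y j fun i hi => hxy i (by omega)]

open Classical in
/-- what is kept of `I` after removing the intervals and the last points before them -/
noncomputable def keep {τ : Type*} (L : Finset τ) (m n : τ → ℕ) (I : Finset ℕ) : Finset ℕ :=
  I \ (L.biUnion (fun l => I.filter (fun x => m l ≤ x ∧ x < n l)) ∪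
    L.image (fun l => (I.filter (· < m l)).sup id))

lemma core {nrm : Finset ℕ → ℕ} (hn : IsAdmissibleNorm nrm)
    (C : Set (Set TT × Finset ℕ × ℝ≥0∞)) (k : ℕ)
    (hC : ∀ c ∈ C, ∃ φ r, k < r ∧ c ∈ EEcl nrm φ r ∧ EEcl nrm φ r ⊆ C)
    (u : PFn) (hu : cK (k + 1) ≤ phiE C (Nset u))
    {τ : Type*} (L : Finset τ) (E : τ → Set TT) (m n : τ → ℕ)
    (hmn : ∀ l ∈ L, m l < n l)
    (hthin : ∀ l ∈ L, IsThin (phiE C) (m l) (n l) (E l))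
    (hdisj : ∀ l ∈ L, ∀ l' ∈ L, l ≠ l' → n l ≤ m l' ∨ n l' ≤ m l)
    (hdom : ∀ l ∈ L, ∀ d ∈ u.dom, ¬ (m l ≤ d ∧ d < n l))
    (G Bd : Finset (Set TT × Finset ℕ × ℝ≥0∞)) (hG : ∀ c ∈ G, c ∈ C) (hBd : ∀ c ∈ Bd, c ∈ C)
    (ty : (Set TT × Finset ℕ × ℝ≥0∞) → τ)
    (hGs : ∑ c ∈ G, c.2.2 < cK k)
    (hGk : ∀ c ∈ G, nrm c.2.1 ≤ 4 * nrm (keep L m n c.2.1))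
    (D : ℕ) (hD : D ≠ 0)
    (hBk : ∀ c ∈ Bd, ty c ∈ L → nrm c.2.1 ≤ D * nrm (c.2.1.filter (fun x => m (ty c) ≤ x ∧ x < n (ty c))))
    (hBs : (D : ℝ≥0∞) ^ aK (k + 1) * ∑ c ∈ Bd, c.2.2 ≤ 1) :
    ∃ x ∈ Nset u, (∀ l ∈ L, x ∉ E l) ∧ (∀ c ∈ G, x ∉ c.1) ∧ ∀ c ∈ Bd, ty c ∈ L → x ∉ c.1 := by
  classical
  have hD1 : (1 : ℝ≥0∞) ≤ D := by exact_mod_cast Nat.one_le_iff_ne_zero.2 hD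
  -- choice of sub-atoms
  have hex : ∀ (l : τ) (x : TT), ∃ e : TT, l ∈ L → (∀ i < m l, e i = x i) ∧
      (∀ y, (∀ i < n l, y i = e i) → y ∉ E l) ∧
      (∀ c ∈ Bd, ty c = l → ∀ y, (∀ i < n l, y i = e i) → y ∉ c.1) := by
    intro l x
    by_cases hl : l ∈ L
    swap
    · exact ⟨x, fun h => absurd h hl⟩
    obtain ⟨H, hB, hH, hφ⟩ := hthin l hl x
    by_contra hcon
    push Not at hcon
    refine absurd hφ (not_lt.2 (le_trans ?_ hBs))
    have hfin := phiE_le_sum C (piMap (m l) x ⁻¹' H) (Bd.filter (fun c => ty c = l))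
      (fun c => (piMap (m l) x ⁻¹' clsn (n l) c.1,
        c.2.1.filter (fun y => m l ≤ y ∧ y < n l), (D : ℝ≥0∞) ^ aK (k + 1) * c.2.2)) (by
        intro c hc
        rw [Finset.mem_filter] at hc
        obtain ⟨hc, hty⟩ := hc
        obtain ⟨φ, r, hr, hcE, hsub⟩ := hC c (hBd c hc)
        refine hsub ⟨?_, ?_, ?_, ?_⟩
        · refine (clopen_of_memB (memB_clsn _ _)).preimage (continuous_caus _ ?_)
          intro y y' j h
          simp only [piMap]
          rw [h j le_rfl]
        · exact (hn.mono _ _ (Finset.filter_subset _ _)).trans hcE.2.1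
        · have h1 := hBk c hc (hty ▸ hl)
          rw [hty] at h1
          refine (wb_scale nrm r D _ _ hD h1).trans ?_
          simp only
          gcongr
          · exact aK_anti hr
          · exact hcE.2.2.1
        · intro a ha b hb hab
          simp only [Finset.mem_filter] at ha hb
          refine thin_pull φ _ _ ?_ a b b hab.le le_rfl ?_ (thin_cls φ _ _ _ _ hb.2.2.le
            (hcE.2.2.2 a ha.1 b hb.1 hab))
          · intro y y' j h
            simp only [piMap]
            rw [h j le_rfl]
          · intro j hj _ y
            simp only [piMap]
            rw [if_neg (by omega)]) (by
        intro z hz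
        have hz' : piMap (m l) x z ∈ H := hz
        have := hcon (piMap (m l) x z)
        have h3 := this.2 (fun i hi => by simp [piMap, hi]) (by
          intro y hy
          exact (hH ((hB y _ hy).2 hz')).2)
        obtain ⟨c, hc, hty, y, hy, hyc⟩ := h3
        simp only [Set.mem_iUnion]
        refine ⟨c, Finset.mem_filter.2 ⟨hc, hty⟩, y, hyc, fun i hi => (hy i hi).symm⟩)
    refine hfin.trans ?_
    rw [Finset.mul_sum]
    exact Finset.sum_le_sum_of_subset (Finset.filter_subset _ _)
  choose e he using hex
  let z0 : TT := fun j => ⟨0, by positivity⟩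
  let S : (j : ℕ) → TT → TT → Fin (2 ^ j) := fun j y pre =>
    if h : ∃ l ∈ L, m l ≤ j ∧ j < n l then e h.choose (piMap (m h.choose) pre z0) j else y j
  let Xi : TT → TT := fun y => XiAux S z0 y
  have hXi : ∀ y j, Xi y j = S j y (piMap j (Xi y) z0) := fun y j => XiAux_eq S z0 y j
  have hin : ∀ l ∈ L, ∀ j, m l ≤ j → j < n l → ∀ y, Xi y j = e l (piMap (m l) (Xi y) z0) j := by
    intro l hl j h1 h2 y
    have hE : ∃ l ∈ L, m l ≤ j ∧ j < n l := ⟨l, hl, h1, h2⟩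
    have hch : hE.choose = l := by
      by_contra hne
      have := hdisj _ hE.choose_spec.1 l hl hne
      have := hE.choose_spec.2
      omega
    rw [hXi]
    simp only [S]
    rw [dif_pos hE, hch]
    have hpm : piMap (m l) (piMap j (Xi y) z0) z0 = piMap (m l) (Xi y) z0 := by
      funext i
      simp only [piMap]
      split_ifs <;> first | rfl | omega
    rw [hpm]
  have hout : ∀ j, (∀ l ∈ L, ¬ (m l ≤ j ∧ j < n l)) → ∀ y, Xi y j = y j := by
    intro j hj y
    rw [hXi]
    simp only [S]
    rw [dif_neg]
    rintro ⟨l, hl, h⟩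
    exact hj l hl h
  have hcaus : ∀ y y' : TT, ∀ j, (∀ i ≤ j, y i = y' i) → Xi y j = Xi y' j := by
    intro y y' j
    induction j using Nat.strong_induction_on with
    | _ j ih =>
      intro h
      have hpre : piMap j (Xi y) z0 = piMap j (Xi y') z0 := by
        funext i
        simp only [piMap]
        split_ifs with hi
        · exact ih i hi fun i' hi' => h i' (by omega)
        · rfl
      rw [hXi, hXi, hpre]
      simp only [S]
      split_ifs
      · rfl
      · exact h j le_rfl
  have h4 : (4 : ℝ≥0∞) ^ aK k ≠ 0 := by
    have := ENNReal.one_le_rpow (x := 4) (by norm_num) (aK_pos k)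
    intro h; rw [h] at this; norm_num at this
  have h4t : (4 : ℝ≥0∞) ^ aK k ≠ ⊤ := ENNReal.rpow_ne_top_of_nonneg (aK_pos k).le (by norm_num)
  have hy : ∃ y ∈ Nset u, ∀ c ∈ G, Xi y ∉ c.1 := by
    by_contra hcon
    push Not at hcon
    have hfin := phiE_le_sum C (Nset u) G
      (fun c => (Xi ⁻¹' c.1, keep L m n c.2.1, (4 : ℝ≥0∞) ^ aK k * c.2.2)) (by
        intro c hc
        obtain ⟨φ, r, hr, hcE, hsub⟩ := hC c (hG c hc)
        refine hsub ⟨?_, ?_, ?_, ?_⟩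
        · exact hcE.1.preimage (continuous_caus _ hcaus)
        · exact (hn.mono _ _ Finset.sdiff_subset).trans hcE.2.1
        · refine (wb_scale nrm r 4 _ _ (by norm_num) (hGk c hc)).trans ?_
          simp only
          push_cast
          gcongr
          · norm_num
          · exact aK_anti hr.le
          · exact hcE.2.2.1
        · intro a ha b hb hab
          simp only [keep, Finset.mem_sdiff, Finset.mem_union, Finset.mem_biUnion, Finset.mem_filter,
            Finset.mem_image, not_or, not_exists, not_and] at ha hb
          -- successor of a
          have hne : (c.2.1.filter (a < ·)).Nonempty := ⟨b, Finset.mem_filter.2 ⟨hb.1, hab⟩⟩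
          set a' := (c.2.1.filter (a < ·)).min' hne with ha'
          have hmem := Finset.mem_filter.1 (Finset.min'_mem _ hne)
          rw [← ha'] at hmem
          have hle : ∀ x ∈ c.2.1, a < x → a' ≤ x := fun x hx hax =>
            Finset.min'_le _ _ (Finset.mem_filter.2 ⟨hx, hax⟩)
          refine thin_pull φ _ _ hcaus a a' b hab.le (hle b hb.1 hab) ?_ (hcE.2.2.2 a ha.1 a' hmem.1 hmem.2)
          intro j hj1 hj2
          refine hout j ?_
          rintro l hl ⟨h1, h2⟩
          have hA1 := ha.2.1 l hl ha.1
          have haml : a < m l := by by_contra h; exact absurd h2 (by have := hA1 (by omega); omega)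
          refine ha.2.2 l hl ?_
          apply le_antisymm
          · refine Finset.sup_le fun x hx => ?_
            rw [Finset.mem_filter] at hx
            by_contra hax
            simp only [id] at hax
            have := hle x hx.1 (by omega)
            omega
          · exact Finset.le_sup (f := id) (Finset.mem_filter.2 ⟨ha.1, haml⟩)) (by
        intro y hy
        obtain ⟨c, hc, h⟩ := hcon y hy
        simp only [Set.mem_iUnion]
        exact ⟨c, hc, h⟩)
    have := hu.trans hfin
    rw [cK, ← Finset.mul_sum] at this
    exact absurd this (not_le.2 (ENNReal.mul_lt_mul_right h4 h4t hGs))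
  obtain ⟨y, hyu, hyG⟩ := hy
  have hag : ∀ l ∈ L, ∀ i < n l, Xi y i = e l (piMap (m l) (Xi y) z0) i := by
    intro l hl i hi
    rcases lt_or_ge i (m l) with h | h
    · rw [(he l _ hl).1 i h]; simp [piMap, h]
    · exact hin l hl i h hi y
  refine ⟨Xi y, ?_, ?_, hyG, ?_⟩
  · intro d hd
    rw [hout d (fun l hl => hdom l hl d hd)]
    exact hyu d hd
  · intro l hl
    exact (he l _ hl).2.1 _ (hag l hl)
  · intro c hc hl
    exact (he _ _ hl).2.2 c hc rfl _ (hag _ hl)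

lemma step {nrm : Finset ℕ → ℕ} (hn : IsAdmissibleNorm nrm)
    (C : Set (Set TT × Finset ℕ × ℝ≥0∞)) (k : ℕ)
    (hC : ∀ c ∈ C, ∃ φ r, k < r ∧ c ∈ EEcl nrm φ r ∧ EEcl nrm φ r ⊆ C)
    (u : PFn) (hu1 : nrm u.dom ≤ 1) (hu : cK (k + 1) ≤ phiE C (Nset u)) :
    cK k ≤ phiE (C ∪ EEcl nrm (phiE C) k) (Nset u) := by
  classical
  conv_rhs => rw [phiE]
  refine le_iInf fun F => le_iInf fun hF => le_iInf fun hcov => ?_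
  by_contra hlt
  push Not at hlt
  have h16 : ∑ c ∈ F, c.2.2 < 16 := hlt.trans_le (cK_le k)
  have hw : ∀ c ∈ F, c.2.2 < 16 := fun c hc =>
    (Finset.single_le_sum (f := fun c : Set TT × Finset ℕ × ℝ≥0∞ => c.2.2) (by simp) hc).trans_lt h16
  set L := F.filter (· ∈ EEcl nrm (phiE C) k) with hL
  set R := F.filter (· ∉ EEcl nrm (phiE C) k) with hR
  have hRC : ∀ c ∈ R, c ∈ C := by
    intro c hc
    rw [hR, Finset.mem_filter] at hc
    exact (hF hc.1).resolve_right hc.2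
  have hLE : ∀ c ∈ L, c ∈ F ∧ c ∈ EEcl nrm (phiE C) k := fun c hc => Finset.mem_filter.1 hc
  -- cardinality of L
  have hs : L.card ≤ 2 ^ (k + 4) := by
    have h1 : (L.card : ℝ≥0∞) * 2 ^ (-(k:ℝ)) ≤ 16 := by
      calc (L.card : ℝ≥0∞) * 2 ^ (-(k:ℝ)) = ∑ c ∈ L, (2:ℝ≥0∞) ^ (-(k:ℝ)) := by simp
        _ ≤ ∑ c ∈ L, c.2.2 := Finset.sum_le_sum fun c hc =>
            (wb_ge nrm k c.2.1 (hLE c hc).2.2.1).trans (hLE c hc).2.2.2.1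
        _ ≤ ∑ c ∈ F, c.2.2 := Finset.sum_le_sum_of_subset (Finset.filter_subset _ _)
        _ ≤ 16 := h16.le
    have h2 : (L.card : ℝ≥0∞) ≤ 2 ^ (k + 4) := by
      calc (L.card : ℝ≥0∞) = (L.card : ℝ≥0∞) * 2 ^ (-(k:ℝ)) * 2 ^ k := by
            rw [mul_assoc, ← ENNReal.rpow_natCast 2 k, ← ENNReal.rpow_add _ _ (by norm_num) (by norm_num)]
            simp
        _ ≤ 16 * 2 ^ k := by gcongr
        _ = 2 ^ (k + 4) := by rw [pow_add]; norm_num [mul_comm]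
    exact_mod_cast h2
  have hpow : 2 ^ (2 * k + 12) = 4 * (2 ^ (k + 4) * 2 ^ (k + 6)) := by
    rw [← pow_add, show k + 4 + (k + 6) = 2 * k + 10 by ring, pow_add 2 (2 * k) 12, pow_add 2 (2*k) 10]; ring
  obtain ⟨m, n, hmn, hdisj⟩ := select hn u.dom hu1
    (fun t : (Set TT × Finset ℕ × ℝ≥0∞) × ℕ => t.1.2.1) _ (L ×ˢ Finset.range (2 ^ (k + 6))) rfl 0 (by
      intro t ht
      rw [Finset.mem_product] at ht
      have h1 := wb_large nrm k t.1.2.1 ((hLE _ ht.1).2.2.2.1.trans_lt (hw _ (hLE _ ht.1).1))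
      rw [Finset.card_product, Finset.card_range]
      simp only [zero_le, Finset.filter_true]
      refine le_trans ?_ h1
      rw [hpow]
      gcongr
      norm_num)
  let kp : ℕ → Finset ℕ → Finset ℕ := fun i I => keep L (fun l => m (l, i)) (fun l => n (l, i)) I
  -- decomposition bounds
  let W : ℕ → Finset ℕ → Finset ℕ := fun i I =>
    L.biUnion (fun l => I.filter (fun x => m (l, i) ≤ x ∧ x < n (l, i)))
  let Z : ℕ → Finset ℕ → Finset ℕ := fun i I =>
    L.image (fun l => (I.filter (· < m (l, i))).sup id)
  have hkp : ∀ i I, kp i I = I \ (W i I ∪ Z i I) := fun i I => by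
    simp only [kp, keep, W, Z]
  have hZ : ∀ i I, nrm (Z i I) ≤ 2 ^ (k + 4) := fun i I =>
    (nrm_le_card hn _).trans (Finset.card_image_le.trans hs)
  have hdec : ∀ i I, nrm (I \ W i I) ≤ nrm (kp i I) + 2 ^ (k + 4) := by
    intro i I
    have h1 : I \ W i I ⊆ kp i I ∪ Z i I := by
      intro x hx
      rw [hkp]
      simp only [Finset.mem_sdiff, Finset.mem_union] at hx ⊢
      tauto
    have := hn.mono _ _ h1
    have := hn.subadd (kp i I) (Z i I)
    have := hZ i I
    omega
  have hbig : ∀ c ∈ R, 2 ^ (k + 10) ≤ nrm c.2.1 := by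
    intro c hc
    obtain ⟨φ, r, hr, hcE, -⟩ := hC c (hRC c hc)
    have h1 := wb_large nrm r c.2.1 (hcE.2.2.1.trans_lt (hw _ (Finset.filter_subset _ _ hc)))
    exact le_trans (Nat.pow_le_pow_right (by norm_num) (by omega)) h1
  have hp10 : 2 ^ (k + 10) = 64 * 2 ^ (k + 4) := by
    rw [show k + 10 = k + 4 + 6 by ring, pow_add]; ring
  have hpos : 0 < 2 ^ (k + 4) := by positivity
  let bad : ℕ → Set TT × Finset ℕ × ℝ≥0∞ → Prop := fun i c => 4 * nrm (kp i c.2.1) < nrm c.2.1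
  have huniq : ∀ c ∈ R, ∀ i ∈ Finset.range (2 ^ (k + 6)), ∀ j ∈ Finset.range (2 ^ (k + 6)),
      bad i c → bad j c → i = j := by
    intro c hc i hi j hj hbi hbj
    by_contra hij
    have hsub : c.2.1 ⊆ (c.2.1 \ W i c.2.1) ∪ (c.2.1 \ W j c.2.1) := by
      intro x hx
      simp only [Finset.mem_union, Finset.mem_sdiff, hx, true_and]
      by_contra hcon
      push Not at hcon
      obtain ⟨h1, h2⟩ := hcon
      simp only [W, Finset.mem_biUnion, Finset.mem_filter] at h1 h2
      obtain ⟨l, hl, -, h1⟩ := h1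
      obtain ⟨l', hl', -, h2⟩ := h2
      have := hdisj (l, i) (Finset.mem_product.2 ⟨hl, hi⟩) (l', j) (Finset.mem_product.2 ⟨hl', hj⟩)
        (fun h => hij (Prod.ext_iff.1 h).2)
      omega
    have h1 := hn.mono _ _ hsub
    have h2 := hn.subadd (c.2.1 \ W i c.2.1) (c.2.1 \ W j c.2.1)
    have h3 := hdec i c.2.1
    have h4 := hdec j c.2.1
    have h5 := hbig c hc
    simp only [bad] at hbi hbj
    omega
  -- choose i
  obtain ⟨i, hi, hsum⟩ : ∃ i ∈ Finset.range (2 ^ (k + 6)),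
      (2 : ℝ≥0∞) ^ (k + 6) * ∑ c ∈ R.filter (bad i), c.2.2 ≤ 16 := by
    by_contra hcon
    push Not at hcon
    have htot : ∑ i ∈ Finset.range (2 ^ (k + 6)), ∑ c ∈ R.filter (bad i), c.2.2 ≤ 16 := by
      calc ∑ i ∈ Finset.range (2 ^ (k + 6)), ∑ c ∈ R.filter (bad i), c.2.2
          = ∑ i ∈ Finset.range (2 ^ (k + 6)), ∑ c ∈ R, if bad i c then c.2.2 else 0 := by
            simp only [Finset.sum_filter]
        _ = ∑ c ∈ R, ∑ i ∈ Finset.range (2 ^ (k + 6)), if bad i c then c.2.2 else 0 :=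
            Finset.sum_comm
        _ ≤ ∑ c ∈ R, c.2.2 := by
            refine Finset.sum_le_sum fun c hc => ?_
            rw [← Finset.sum_filter, Finset.sum_const, _root_.nsmul_eq_mul]
            have : ((Finset.range (2 ^ (k + 6))).filter (fun i => bad i c)).card ≤ 1 := by
              rw [Finset.card_le_one]
              intro a ha b hb
              rw [Finset.mem_filter] at ha hb
              exact huniq c hc a ha.1 b hb.1 ha.2 hb.2
            calc _ ≤ ((1:ℕ):ℝ≥0∞) * c.2.2 := by gcongr
              _ = c.2.2 := by simp
        _ ≤ ∑ c ∈ F, c.2.2 := Finset.sum_le_sum_of_subset (Finset.filter_subset _ _)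
        _ ≤ 16 := h16.le
    have hlow : ∑ i ∈ Finset.range (2 ^ (k + 6)), (16:ℝ≥0∞) <
        ∑ i ∈ Finset.range (2 ^ (k + 6)), (2 : ℝ≥0∞) ^ (k + 6) * ∑ c ∈ R.filter (bad i), c.2.2 :=
      ENNReal.sum_lt_sum_of_nonempty (by simp) hcon
    rw [← Finset.mul_sum, Finset.sum_const, Finset.card_range, _root_.nsmul_eq_mul] at hlow
    push_cast at hlow
    exact absurd hlow (not_lt.2 (by gcongr))
  -- types of the bad ones
  have hty : ∀ c ∈ R, bad i c → ∃ l ∈ L, nrm c.2.1 ≤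
      2 ^ (k + 5) * nrm (c.2.1.filter (fun x => m (l, i) ≤ x ∧ x < n (l, i))) := by
    intro c hc hb
    by_contra hcon
    push Not at hcon
    have h1 := hn.mono c.2.1 (W i c.2.1 ∪ (c.2.1 \ W i c.2.1)) (by
      intro x hx
      simp only [Finset.mem_union, Finset.mem_sdiff]
      tauto)
    have h2 := hn.subadd (W i c.2.1) (c.2.1 \ W i c.2.1)
    have h3 := hdec i c.2.1
    have h4 : nrm (W i c.2.1) ≤ _ := nrm_biUnion hn L _
    have h5 := hbig c hc
    have h6 : 2 ^ (k + 5) * ∑ l ∈ L, nrm (c.2.1.filter (fun x => m (l, i) ≤ x ∧ x < n (l, i)))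
        ≤ 2 ^ (k + 4) * nrm c.2.1 := by
      rw [Finset.mul_sum]
      calc _ ≤ ∑ l ∈ L, nrm c.2.1 := Finset.sum_le_sum fun l hl => (hcon l hl).le
        _ = L.card * nrm c.2.1 := by simp
        _ ≤ _ := by gcongr
    rw [show k + 5 = k + 4 + 1 by ring, pow_succ, mul_assoc] at h6
    have h7 := Nat.le_of_mul_le_mul_left h6 hpos
    simp only [bad] at hb
    omega
  have hty' : ∀ c : Set TT × Finset ℕ × ℝ≥0∞, ∃ l, c ∈ R → bad i c → l ∈ L ∧ nrm c.2.1 ≤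
      2 ^ (k + 5) * nrm (c.2.1.filter (fun x => m (l, i) ≤ x ∧ x < n (l, i))) := by
    intro c
    by_cases h : c ∈ R ∧ bad i c
    · obtain ⟨l, h1, h2⟩ := hty c h.1 h.2
      exact ⟨l, fun _ _ => ⟨h1, h2⟩⟩
    · exact ⟨c, fun h1 h2 => absurd ⟨h1, h2⟩ h⟩
  choose ty hty2 using hty'
  have hm' : ∀ l ∈ L, (l, i) ∈ L ×ˢ Finset.range (2 ^ (k + 6)) := fun l hl =>
    Finset.mem_product.2 ⟨hl, hi⟩
  obtain ⟨x, hxu, hxL, hxG, hxB⟩ := core hn C k hC u hu L (fun l => l.1) (fun l => m (l, i))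
    (fun l => n (l, i)) (fun l hl => (hmn _ (hm' l hl)).2.2.2.1)
    (fun l hl => (hLE l hl).2.2.2.2 _ (hmn _ (hm' l hl)).1 _ (hmn _ (hm' l hl)).2.1
      (hmn _ (hm' l hl)).2.2.2.1)
    (fun l hl l' hl' hne => hdisj _ (hm' l hl) _ (hm' l' hl') (fun h => hne (Prod.ext_iff.1 h).1))
    (fun l hl => (hmn _ (hm' l hl)).2.2.2.2)
    (R.filter (fun c => ¬ bad i c)) (R.filter (bad i))
    (fun c hc => hRC c (Finset.filter_subset _ _ hc))
    (fun c hc => hRC c (Finset.filter_subset _ _ hc)) ty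
    (lt_of_le_of_lt (Finset.sum_le_sum_of_subset
      ((Finset.filter_subset _ _).trans (Finset.filter_subset _ _))) hlt)
    (fun c hc => not_lt.1 (Finset.mem_filter.1 hc).2)
    (2 ^ (k + 5)) (by positivity)
    (fun c hc _ => (hty2 c (Finset.mem_filter.1 hc).1 (Finset.mem_filter.1 hc).2).2) (by
      have h2 : (((2 ^ (k + 5) : ℕ) : ℝ≥0∞)) ^ aK (k + 1) ≤ 2 := by
        push_cast
        rw [← ENNReal.rpow_natCast, ← ENNReal.rpow_mul]
        calc (2:ℝ≥0∞) ^ (((k + 5 : ℕ) : ℝ) * aK (k + 1)) ≤ 2 ^ (1:ℝ) := by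
              gcongr
              · norm_num
              unfold aK
              push_cast
              have hk : (0:ℝ) ≤ k := by positivity
              rw [mul_one_div, div_le_one (by positivity)]
              nlinarith [mul_nonneg hk hk, mul_nonneg hk (mul_nonneg hk hk)]
          _ = 2 := by simp
      calc _ ≤ 2 * ∑ c ∈ R.filter (bad i), c.2.2 := by gcongr
        _ ≤ 1 := by
          have h3 : (64:ℝ≥0∞) * ∑ c ∈ R.filter (bad i), c.2.2 ≤ 16 := by
            refine le_trans ?_ hsum
            gcongr
            rw [pow_add]
            calc (64:ℝ≥0∞) = 1 * 2 ^ 6 := by norm_num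
              _ ≤ _ := by gcongr; exact one_le_pow₀ (by norm_num)
          have h4 : (16:ℝ≥0∞) * (2 * ∑ c ∈ R.filter (bad i), c.2.2) ≤ 16 * 1 := by
            calc _ = (32:ℝ≥0∞) * ∑ c ∈ R.filter (bad i), c.2.2 := by ring
              _ ≤ (64:ℝ≥0∞) * ∑ c ∈ R.filter (bad i), c.2.2 := by gcongr; norm_num
              _ ≤ _ := by simpa using h3
          exact (ENNReal.mul_le_mul_iff_right (by norm_num) (by norm_num)).1 h4)
  have := hcov hxu
  simp only [Set.mem_iUnion] at this
  obtain ⟨c, hc, hxc⟩ := this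
  by_cases h1 : c ∈ EEcl nrm (phiE C) k
  · exact hxL c (Finset.mem_filter.2 ⟨hc, h1⟩) hxc
  · have hcR : c ∈ R := Finset.mem_filter.2 ⟨hc, h1⟩
    by_cases hb : bad i c
    · exact hxB c (Finset.mem_filter.2 ⟨hcR, hb⟩) (hty2 c hcR hb).1 hxc
    · exact hxG c (Finset.mem_filter.2 ⟨hcR, hb⟩) hxc

lemma Cstage_spec (nrm : Finset ℕ → ℕ) (p : ℕ) : ∀ j, j ≤ p → ∀ c ∈ Cstage nrm p j,
    ∃ φ r, p < r + j + 1 ∧ c ∈ EEcl nrm φ r ∧ EEcl nrm φ r ⊆ Cstage nrm p j := by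
  intro j
  induction j with
  | zero => intro _ c hc; exact absurd hc (by simp [Cstage])
  | succ j ih =>
    intro hj c hc
    rw [Cstage] at hc ⊢
    rcases hc with hc | hc
    · obtain ⟨φ, r, h1, h2, h3⟩ := ih (by omega) c hc
      exact ⟨φ, r, by omega, h2, h3.trans Set.subset_union_left⟩
    · exact ⟨_, _, by omega, hc, Set.subset_union_right⟩

lemma Nset_nonempty (u : PFn) : (Nset u).Nonempty := by
  refine ⟨fun k => ⟨u.val k, ?_⟩, fun k _ => rfl⟩
  by_cases h : k ∈ u.dom
  · exact u.lt k h
  · rw [u.out k h]; positivity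

lemma main_ind {nrm : Finset ℕ → ℕ} (hn : IsAdmissibleNorm nrm) (p : ℕ) : ∀ j, j ≤ p →
    ∀ u : PFn, nrm u.dom ≤ 1 → cK (p - j) ≤ phiE (Cstage nrm p j) (Nset u) := by
  intro j
  induction j with
  | zero =>
    intro _ u _
    rw [Cstage, phiE]
    refine le_iInf fun F => le_iInf fun hF => le_iInf fun hcov => ?_
    obtain ⟨x, hx⟩ := Nset_nonempty u
    have := hcov hx
    simp only [Set.mem_iUnion] at this
    obtain ⟨c, hc, -⟩ := this
    exact absurd (hF hc) (by simp)
  | succ j ih =>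
    intro hj u hu
    rw [Cstage]
    refine step hn _ _ ?_ u hu ?_
    · intro c hc
      obtain ⟨φ, r, h1, h2, h3⟩ := Cstage_spec nrm p j (by omega) c hc
      exact ⟨φ, r, by omega, h2, h3⟩
    · rw [show p - (j + 1) + 1 = p - j by omega]
      exact ih (by omega) u hu

end aux

/-- Proposition 3.6 (lower bound): for `k ≤ p`, `ν_{k,p}(N_u) ≥ c_k` for every `u ∈ 𝒫`
with `‖dom u‖ ≤ 1`; in particular `ν_{k,p}(T) ≥ c_k ≥ 8`. -/
theorem nuKP_lower_bound (nrm : Finset ℕ → ℕ) (hn : IsAdmissibleNorm nrm)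
    (k p : ℕ) (hkp : k ≤ p) :
    (∀ u : PFn, nrm u.dom ≤ 1 → cK k ≤ nuKP nrm k p (Nset u)) ∧
      cK k ≤ nuKP nrm k p Set.univ ∧ (8 : ℝ≥0∞) ≤ cK k := by
  have h : ∀ u : PFn, nrm u.dom ≤ 1 → cK k ≤ nuKP nrm k p (Nset u) := by
    intro u hu
    have := main_ind hn p (p - k) (by omega) u hu
    rwa [show p - (p - k) = k by omega] at this
  refine ⟨h, ?_, cK_ge k⟩
  have := h ⟨∅, fun _ => 0, by simp, by simp⟩ (by simp [hn.empty])
  have he : Nset ⟨∅, fun _ => 0, by simp, by simp⟩ = Set.univ := by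
    ext x; simp [Nset]
  rwa [he] at this
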